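/- arXiv:2106.04218 — 2 statements merged into one kernel-verified Lean document; each statement's English description precedes it below -/
import Mathlib

section
/- For each natural number n, the 2n-th moment of the standardized hyperbolic secant distribution equals the absolute value of the 2n-th Euler number: ∫_{-∞}^{∞} x^{2n} · (1/2)·sech(πx/2) dx = |E_{2n}|. -/
open MeasureTheory Real

noncomputable def hsDensity (x : ℝ) : ℝ := (1 / 2) * (Real.cosh (Real.pi * x / 2))⁻¹

lemma hsDensity_nonneg (x : ℝ) : 0 ≤ hsDensity x := by
  unfold hsDensity
  have := Real.cosh_pos (Real.pi * x / 2)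
  positivity

lemma hsDensity_continuous : Continuous hsDensity := by
  unfold hsDensity
  refine continuous_const.mul (Continuous.inv₀ (Real.continuous_cosh.comp (by fun_prop)) ?_)
  intro x
  exact (Real.cosh_pos _).ne'

lemma hsDensity_le (x : ℝ) : hsDensity x ≤ Real.exp (-(Real.pi / 2 * |x|)) := by
  unfold hsDensity
  have h : Real.exp (Real.pi / 2 * |x|) ≤ 2 * Real.cosh (Real.pi * x / 2) := by
    rw [← Real.cosh_abs, Real.cosh_eq]
    have : |Real.pi * x / 2| = Real.pi / 2 * |x| := by
      rw [abs_div, abs_mul, abs_of_pos Real.pi_pos, abs_two]; ring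
    rw [this]
    have := Real.exp_pos (-(Real.pi / 2 * |x|))
    linarith
  rw [Real.exp_neg, one_div, ← mul_inv]
  exact inv_anti₀ (Real.exp_pos _) h

lemma integrable_exp_neg_abs {c : ℝ} (hc : 0 < c) :
    Integrable (fun x : ℝ => Real.exp (-(c * |x|))) := by
  rw [← integrableOn_univ, ← Set.Iic_union_Ioi (a := (0 : ℝ))]
  refine IntegrableOn.union ?_ ?_
  · refine (integrableOn_exp_mul_Iic hc 0).congr_fun (fun x hx => ?_) measurableSet_Iic
    simp only [Set.mem_Iic] at hx
    simp [abs_of_nonpos hx]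
  · refine (integrableOn_exp_mul_Ioi (neg_lt_zero.mpr hc) 0).congr_fun (fun x hx => ?_)
      measurableSet_Ioi
    simp only [Set.mem_Ioi] at hx
    simp [abs_of_pos hx]

lemma hs_point (t y : ℝ) :
    |Real.sigmoid (π * y) * (1 - Real.sigmoid (π * y)) * π| •
      (((Real.sigmoid (π * y) : ℝ) : ℂ) ^ ((1 / 2 + t / π * Complex.I : ℂ) - 1) *
        (1 - ((Real.sigmoid (π * y) : ℝ) : ℂ)) ^ ((1 - (1 / 2 + t / π * Complex.I) : ℂ) - 1))
    = π * (Complex.exp (t * y * Complex.I) * (hsDensity y : ℂ)) := by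
  have hpi : (π : ℂ) ≠ 0 := Complex.ofReal_ne_zero.mpr Real.pi_ne_zero
  obtain ⟨L, hL⟩ : ∃ L : ℝ, Real.sigmoid (π * y) = Real.exp L :=
    ⟨Real.log (Real.sigmoid (π * y)), (Real.exp_log (Real.sigmoid_pos _)).symm⟩
  have h1 : 1 - Real.sigmoid (π * y) = Real.exp (L - π * y) := by
    rw [← Real.sigmoid_neg, ← Real.sigmoid_mul_rexp_neg, hL, ← Real.exp_add]; ring_nf
  have h1c : 1 - ((Real.sigmoid (π * y) : ℝ) : ℂ) = ((Real.exp (L - π * y) : ℝ) : ℂ) := by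
    rw [← h1]; push_cast; rfl
  have hd : hsDensity y = Real.exp (L - π * y / 2) := by
    unfold hsDensity
    rw [Real.exp_sub, ← hL, Real.sigmoid_def, Real.cosh_eq]
    have : Real.exp (-(π * y)) = Real.exp (-(π * y / 2)) * Real.exp (-(π * y / 2)) := by
      rw [← Real.exp_add]; ring_nf
    rw [this, Real.exp_neg]
    have := Real.exp_pos (π * y / 2)
    field_simp
  rw [h1, h1c, hL, hd, abs_of_pos (by positivity), Complex.real_smul,
    Complex.cpow_def_of_ne_zero (by exact_mod_cast (Real.exp_pos _).ne'),
    Complex.cpow_def_of_ne_zero (by exact_mod_cast (Real.exp_pos _).ne'),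
    ← Complex.ofReal_log (Real.exp_pos _).le, ← Complex.ofReal_log (Real.exp_pos _).le,
    Real.log_exp, Real.log_exp]
  push_cast
  rw [mul_comm _ (π : ℂ), mul_assoc, ← Complex.exp_add, ← Complex.exp_add, ← Complex.exp_add,
    ← Complex.exp_add]
  congr 2
  field_simp
  ring

lemma hs_charFun (t : ℝ) :
    ∫ y : ℝ, Complex.exp (t * y * Complex.I) * (hsDensity y : ℂ) = ((Real.cosh t)⁻¹ : ℝ) := by
  have hpi : (π : ℂ) ≠ 0 := Complex.ofReal_ne_zero.mpr Real.pi_ne_zero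
  set u : ℂ := 1 / 2 + t / π * Complex.I with hu
  have hre : u.re = 1 / 2 := by
    rw [hu, ← Complex.ofReal_div]; simp
  have hB : Complex.betaIntegral u (1 - u) = π / Complex.cosh t := by
    have h := Complex.Gamma_mul_Gamma_eq_betaIntegral (s := u) (t := 1 - u)
      (by rw [hre]; norm_num) (by rw [Complex.sub_re, hre]; norm_num)
    rw [Complex.Gamma_mul_Gamma_one_sub, add_sub_cancel, Complex.Gamma_one, one_mul] at h
    rw [← h]
    congr 1
    rw [← Complex.cos_mul_I, ← Complex.sin_add_pi_div_two]
    congr 1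
    rw [hu]; field_simp; ring
  have hinj : Set.InjOn (fun y : ℝ => Real.sigmoid (π * y)) Set.univ := by
    intro a _ b _ hab
    exact mul_left_cancel₀ Real.pi_ne_zero (Real.sigmoid_injective hab)
  have himg : (fun y : ℝ => Real.sigmoid (π * y)) '' Set.univ = Set.Ioo 0 1 := by
    rw [Set.image_univ, ← Real.range_sigmoid]
    exact (mul_left_surjective₀ Real.pi_ne_zero).range_comp Real.sigmoid
  have hcv := integral_image_eq_integral_abs_deriv_smul (s := Set.univ)
    (f := fun y : ℝ => Real.sigmoid (π * y))
    (f' := fun y => Real.sigmoid (π * y) * (1 - Real.sigmoid (π * y)) * π)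
    MeasurableSet.univ
    (fun x _ => by
      have h2 : HasDerivAt (fun y : ℝ => π * y) π x := by
        simpa using (hasDerivAt_id x).const_mul π
      exact ((Real.hasDerivAt_sigmoid (π * x)).comp x h2).hasDerivWithinAt)
    hinj (fun x : ℝ => (x : ℂ) ^ (u - 1) * (1 - (x : ℂ)) ^ ((1 - u) - 1))
  rw [himg, ← integral_Ioc_eq_integral_Ioo,
    ← intervalIntegral.integral_of_le zero_le_one] at hcv
  change Complex.betaIntegral u (1 - u) = _ at hcv
  rw [hB, Measure.restrict_univ] at hcv
  simp_rw [hu, hs_point] at hcv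
  rw [integral_const_mul, div_eq_mul_inv] at hcv
  rw [← mul_left_cancel₀ hpi hcv]
  push_cast
  rfl

lemma hs_exp_integrable (t : ℝ) :
    Integrable (fun y : ℝ => Complex.exp (t * y * Complex.I) * (hsDensity y : ℂ)) := by
  refine (integrable_exp_neg_abs (c := π / 2) (by positivity)).mono' ?_ (ae_of_all _ fun x => ?_)
  · have := hsDensity_continuous
    exact (by fun_prop : Continuous _).aestronglyMeasurable
  · rw [norm_mul, ← Complex.ofReal_mul, Complex.norm_exp_ofReal_mul_I, one_mul, Complex.norm_real,
      Real.norm_of_nonneg (hsDensity_nonneg x)]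
    exact hsDensity_le x

lemma hs_cos (t : ℝ) : ∫ y : ℝ, Real.cos (t * y) * hsDensity y = (Real.cosh t)⁻¹ := by
  have h := congrArg Complex.re (hs_charFun t)
  rw [Complex.ofReal_re] at h
  rw [← h]
  have h2 := integral_re (𝕜 := ℂ) (hs_exp_integrable t)
  simp only [RCLike.re_eq_complex_re] at h2
  rw [← h2]
  congr 1
  ext y
  rw [Complex.re_mul_ofReal, ← Complex.ofReal_mul, Complex.exp_ofReal_mul_I_re]

lemma hs_hasSum {t : ℝ} (ht : |t| < 1) :
    HasSum (fun n : ℕ => ((-1) ^ n * ∫ x : ℝ, x ^ (2 * n) * hsDensity x) * t ^ (2 * n)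
      / (Nat.factorial (2 * n) : ℝ)) (Real.cosh t)⁻¹ := by
  have hcont := hsDensity_continuous
  have hb (x : ℝ) : HasSum (fun n : ℕ => (t * x) ^ (2 * n) / (Nat.factorial (2 * n) : ℝ)
      * hsDensity x) (Real.cosh (t * x) * hsDensity x) := (Real.hasSum_cosh (t * x)).mul_right _
  have key := hasSum_integral_of_dominated_convergence (μ := (volume : Measure ℝ))
    (F := fun (n : ℕ) (x : ℝ) => (-1) ^ n * (t * x) ^ (2 * n) / (Nat.factorial (2 * n) : ℝ)
      * hsDensity x)
    (f := fun x => Real.cos (t * x) * hsDensity x)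
    (fun n x => (t * x) ^ (2 * n) / (Nat.factorial (2 * n) : ℝ) * hsDensity x)
    (fun n => (by fun_prop : Continuous _).aestronglyMeasurable)
    (fun n => ae_of_all _ fun x => by
      rw [norm_mul, norm_div, norm_mul, norm_pow, norm_neg, norm_one, one_pow, one_mul,
        Real.norm_of_nonneg (hsDensity_nonneg x), Real.norm_natCast,
        Real.norm_of_nonneg ((even_two_mul n).pow_nonneg _)])
    (ae_of_all _ fun x => (hb x).summable)
    (by
      simp_rw [fun x => (hb x).tsum_eq]
      refine (integrable_exp_neg_abs (c := π / 2 - 1)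
        (by linarith [Real.pi_gt_three])).mono' ?_ (ae_of_all _ fun x => ?_)
      · have := Real.continuous_cosh
        exact (by fun_prop : Continuous _).aestronglyMeasurable
      · rw [Real.norm_of_nonneg (mul_nonneg (Real.cosh_pos _).le (hsDensity_nonneg x))]
        have h1 : Real.cosh (t * x) ≤ Real.exp |x| := by
          have h2 : |t * x| ≤ |x| := by
            rw [abs_mul]; nlinarith [abs_nonneg x]
          rw [← Real.cosh_abs, Real.cosh_eq]
          have h3 : Real.exp |t * x| ≤ Real.exp |x| := Real.exp_le_exp.mpr h2
          have h4 : Real.exp (-|t * x|) ≤ Real.exp |x| :=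
            Real.exp_le_exp.mpr (by linarith [abs_nonneg (t * x), abs_nonneg x])
          linarith
        calc _ ≤ Real.exp |x| * Real.exp (-(π / 2 * |x|)) :=
              mul_le_mul h1 (hsDensity_le x) (hsDensity_nonneg x) (Real.exp_pos _).le
          _ = _ := by rw [← Real.exp_add]; ring_nf)
    (ae_of_all _ fun x => (Real.hasSum_cos (t * x)).mul_right _)
  rw [hs_cos] at key
  convert! key using 2 with n
  rw [show (fun x : ℝ => (-1) ^ n * (t * x) ^ (2 * n) / (Nat.factorial (2 * n) : ℝ) * hsDensity x)
    = fun x => ((-1) ^ n * t ^ (2 * n) / (Nat.factorial (2 * n) : ℝ)) *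
      (x ^ (2 * n) * hsDensity x) by ext x; rw [mul_pow]; ring]
  rw [integral_const_mul]
  ring

lemma even_series_unique {c d : ℕ → ℝ} {f : ℝ → ℝ}
    (hc : ∀ t : ℝ, |t| < 1 → HasSum (fun n => c n * t ^ (2 * n)) (f t))
    (hd : ∀ t : ℝ, |t| < 1 → HasSum (fun n => d n * t ^ (2 * n)) (f t)) (n : ℕ) :
    c n = d n := by
  have key (c : ℕ → ℝ) (hc : ∀ t : ℝ, |t| < 1 → HasSum (fun n => c n * t ^ (2 * n)) (f t)) :
      HasFPowerSeriesAt f (FormalMultilinearSeries.ofScalars ℝ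
        (fun k => if Even k then c (k / 2) else 0)) 0 := by
    rw [hasFPowerSeriesAt_iff]
    filter_upwards [Metric.ball_mem_nhds (0 : ℝ) one_pos] with t ht
    rw [mem_ball_zero_iff, Real.norm_eq_abs] at ht
    have hinj : Function.Injective (fun n : ℕ => 2 * n) := fun a b h => by
      simpa using h
    rw [zero_add, ← hinj.hasSum_iff]
    · convert! hc t ht using 2 with m
      simp [FormalMultilinearSeries.coeff_ofScalars, mul_comm]
    · intro k hk
      have : ¬ Even k := fun ⟨m, hm⟩ => hk ⟨m, by simp only; omega⟩
      simp [FormalMultilinearSeries.coeff_ofScalars, this]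
  have h := (key c hc).eq_formalMultilinearSeries (key d hd)
  have h2 := congrArg (fun p => p.coeff (2 * n)) h
  simpa [FormalMultilinearSeries.coeff_ofScalars] using h2

/-- If `E n` is the `2n`-th Euler number, i.e. `sech t = ∑ E n * t^(2n)/(2n)!`
for `|t| < π/2`, then the `2n`-th moment of the standardized hyperbolic secant
distribution equals `|E n|`. -/
theorem hs_even_moments_eq_abs_euler
    (E : ℕ → ℝ)
    (hE : ∀ t : ℝ, |t| < Real.pi / 2 →
      HasSum (fun n : ℕ => E n * t ^ (2 * n) / (Nat.factorial (2 * n) : ℝ))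
        (Real.cosh t)⁻¹)
    (n : ℕ) :
    ∫ x : ℝ, x ^ (2 * n) * hsDensity x = |E n| := by
  have hpi := Real.pi_gt_three
  have h := even_series_unique (f := fun t => (Real.cosh t)⁻¹)
    (c := fun n => E n / (Nat.factorial (2 * n) : ℝ))
    (d := fun n => ((-1) ^ n * ∫ x : ℝ, x ^ (2 * n) * hsDensity x) /
      (Nat.factorial (2 * n) : ℝ))
    (fun t ht => by simpa only [div_mul_eq_mul_div] using hE t (by linarith))
    (fun t ht => by simpa only [div_mul_eq_mul_div] using hs_hasSum ht) n
  have hf : (Nat.factorial (2 * n) : ℝ) ≠ 0 := by positivity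
  have hEn := (div_left_inj' hf).mp h
  rw [hEn, abs_mul, abs_pow, abs_neg, abs_one, one_pow, one_mul, abs_of_nonneg]
  exact integral_nonneg fun x => mul_nonneg ((even_two_mul n).pow_nonneg x) (hsDensity_nonneg x)
end

section
/- The Fourier transform of the convoluted linear hyperbolic density (y/2)·csch(πy/2) equals sech(ω)²: ∫_{-∞}^{∞} e^{iωy} · (y/2)·csch(πy/2) dy = sech(ω)² for all real ω. -/
open MeasureTheory Real

noncomputable def clhDensity (y : ℝ) : ℝ :=
  if y = 0 then 1 / Real.pi else (y / 2) * (Real.sinh (Real.pi * y / 2))⁻¹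

theorem clh_one_add_sq_le_cosh (x : ℝ) : 1 + x ^ 2 / 2 ≤ Real.cosh x := by
  have h : Real.cosh x = 1 + 2 * Real.sinh (x / 2) ^ 2 := by
    have h1 := Real.cosh_two_mul (x / 2)
    have h2 := Real.cosh_sq (x / 2)
    rw [show 2 * (x / 2) = x by ring] at h1
    linarith
  have h3 : (x / 2) ^ 2 ≤ Real.sinh (x / 2) ^ 2 := by
    rcases le_total 0 x with hx | hx
    · have := Real.self_le_sinh_iff.2 (show 0 ≤ x / 2 by linarith)
      gcongr
    · have := Real.self_le_sinh_iff.2 (show 0 ≤ -(x / 2) by linarith)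
      rw [Real.sinh_neg] at this
      nlinarith
  rw [h]
  nlinarith

theorem clh_sech_integrable :
    Integrable (fun x : ℝ => ((((Real.cosh x)⁻¹ : ℝ) : ℂ) ^ 2)) := by
  refine integrable_inv_one_add_sq.mono' ?_ ?_
  · have : Continuous (fun x : ℝ => ((((Real.cosh x)⁻¹ : ℝ) : ℂ) ^ 2)) := by
      have : Continuous (fun x : ℝ => (Real.cosh x)⁻¹) :=
        Real.continuous_cosh.inv₀ fun x => (Real.cosh_pos x).ne'
      fun_prop
    exact this.aestronglyMeasurable
  · refine Filter.Eventually.of_forall fun x => ?_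
    rw [norm_pow, Complex.norm_real, Real.norm_eq_abs, sq_abs, inv_pow]
    have := clh_one_add_sq_le_cosh x
    apply inv_anti₀ (by positivity)
    nlinarith [sq_nonneg x]

theorem clh_density_neg (y : ℝ) : clhDensity (-y) = clhDensity y := by
  unfold clhDensity
  by_cases h : y = 0
  · simp [h]
  · simp only [neg_eq_zero, h, if_false]
    rw [show π * -y / 2 = -(π * y / 2) by ring, Real.sinh_neg, inv_neg]
    ring

theorem clh_density_bound (y : ℝ) (hy : 0 ≤ y) : |clhDensity y| ≤ 8 * (1 + y ^ 2)⁻¹ := by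
  have hpi := Real.pi_gt_three
  rcases hy.eq_or_lt with rfl | hy
  · simp only [clhDensity, if_true]
    rw [abs_of_pos (by positivity), div_le_iff₀ (by positivity)]
    norm_num
    linarith
  · have hs : 0 < Real.sinh (π * y / 2) := Real.sinh_pos_iff.2 (by positivity)
    simp only [clhDensity, hy.ne', if_false]
    rw [abs_of_pos (by positivity), ← div_eq_mul_inv, ← div_eq_mul_inv,
      div_le_div_iff₀ hs (by positivity)]
    have h1 : Real.sinh (π * y / 2) = 2 * Real.sinh (π * y / 4) * Real.cosh (π * y / 4) := by
      rw [← Real.sinh_two_mul]; congr 1; ring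
    have h2 := Real.self_le_sinh_iff.2 (show 0 ≤ π * y / 4 by positivity)
    have h3 := clh_one_add_sq_le_cosh (π * y / 4)
    have h4 : 3 * y / 4 ≤ Real.sinh (π * y / 4) := by nlinarith
    have h5 : 1 + (3 * y / 4) ^ 2 / 2 ≤ Real.cosh (π * y / 4) := by
      refine le_trans ?_ h3
      have : 3 * y / 4 ≤ π * y / 4 := by nlinarith
      gcongr
    have h6 := mul_le_mul h4 h5 (by positivity) (by linarith [show 0 ≤ 3 * y / 4 by positivity])
    rw [h1]
    have : 0 < y ^ 3 := by positivity
    nlinarith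

theorem clh_density_integrable : Integrable clhDensity := by
  refine (integrable_inv_one_add_sq.const_mul 8).mono' ?_ ?_
  · apply Measurable.aestronglyMeasurable
    unfold clhDensity
    refine Measurable.ite (measurableSet_eq) measurable_const ?_
    have := Real.measurable_sinh
    fun_prop
  · refine Filter.Eventually.of_forall fun x => ?_
    rw [Real.norm_eq_abs]
    rcases le_total 0 x with hx | hx
    · exact clh_density_bound x hx
    · have := clh_density_bound (-x) (by linarith)
      rwa [clh_density_neg, neg_sq] at this

theorem clh_beta_eq (y : ℝ) :
    Complex.betaIntegral (1 + Complex.I * (y / 2)) (1 - Complex.I * (y / 2))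
      = π * clhDensity y := by
  have h := Complex.Gamma_mul_Gamma_eq_betaIntegral
    (s := 1 + Complex.I * (y / 2)) (t := 1 - Complex.I * (y / 2)) (by simp) (by simp)
  have hG : Complex.Gamma 2 = 1 := by norm_num
  rw [show (1 + Complex.I * (y / 2)) + (1 - Complex.I * (y / 2)) = (2 : ℂ) by ring,
    hG, one_mul] at h
  rw [← h]
  by_cases hy : y = 0
  · subst hy
    simp [clhDensity]
  · have hne : Complex.I * ((y : ℂ) / 2) ≠ 0 := by simp [hy]
    rw [add_comm (1 : ℂ), Complex.Gamma_add_one _ hne, mul_assoc, Complex.Gamma_mul_Gamma_one_sub,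
      show (π : ℂ) * (Complex.I * (y / 2)) = ((π * y / 2 : ℝ) : ℂ) * Complex.I by push_cast; ring,
      Complex.sin_mul_I]
    have hs : Real.sinh (π * y / 2) ≠ 0 := by
      rw [Ne, Real.sinh_eq_zero]; positivity
    have hs' : Complex.sinh ((π * y / 2 : ℝ) : ℂ) ≠ 0 := by
      rw [← Complex.ofReal_sinh]; exact_mod_cast hs
    simp only [clhDensity, hy, if_false]
    push_cast at hs' ⊢
    field_simp

theorem clh_sech_fourier (y : ℝ) :
    ∫ w : ℝ, Complex.exp (Complex.I * y * w) * (((Real.cosh w)⁻¹ : ℝ) : ℂ) ^ 2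
      = 2 * π * clhDensity y := by
  have hd : ∀ w ∈ (Set.univ : Set ℝ), HasDerivWithinAt (fun w : ℝ => Real.sigmoid (2 * w))
      (Real.sigmoid (2 * w) * (1 - Real.sigmoid (2 * w)) * 2) Set.univ w := by
    intro w _
    have h1 : HasDerivAt (fun w : ℝ => 2 * w) 2 w := by
      simpa using (hasDerivAt_id w).const_mul 2
    exact ((Real.hasDerivAt_sigmoid (2 * w)).comp w h1).hasDerivWithinAt
  have hi : Set.InjOn (fun w : ℝ => Real.sigmoid (2 * w)) Set.univ := by
    intro a _ b _ hab
    have := Real.sigmoid_injective hab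
    linarith
  have himg : (fun w : ℝ => Real.sigmoid (2 * w)) '' Set.univ = Set.Ioo 0 1 := by
    rw [← Real.range_sigmoid, Set.image_univ]
    ext x
    constructor
    · rintro ⟨w, rfl⟩; exact ⟨_, rfl⟩
    · rintro ⟨w, rfl⟩; exact ⟨w / 2, by simp only []; congr 1; ring⟩
  have key := integral_image_eq_integral_abs_deriv_smul MeasurableSet.univ hd hi
    (fun x : ℝ => (x : ℂ) ^ ((1 + Complex.I * (y / 2)) - 1)
      * (1 - (x : ℂ)) ^ ((1 - Complex.I * (y / 2)) - 1))
  rw [himg, setIntegral_univ, ← integral_Ioc_eq_integral_Ioo,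
    ← intervalIntegral.integral_of_le zero_le_one] at key
  change Complex.betaIntegral _ _ = _ at key
  rw [clh_beta_eq] at key
  rw [mul_assoc, key, ← integral_const_mul]
  refine integral_congr_ae (Filter.Eventually.of_forall fun w => ?_)
  simp only []
  have hp := Real.sigmoid_pos (2 * w)
  have hp' : 0 < 1 - Real.sigmoid (2 * w) := by linarith [Real.sigmoid_lt_one (2 * w)]
  have hlog : Real.log (Real.sigmoid (2 * w)) - Real.log (1 - Real.sigmoid (2 * w)) = 2 * w := by
    rw [← Real.sigmoid_neg, ← Real.sigmoid_mul_rexp_neg, Real.log_mul hp.ne' (Real.exp_pos _).ne',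
      Real.log_exp]
    ring
  have hsech : (Real.cosh w)⁻¹ ^ 2 = 4 * (Real.sigmoid (2 * w) * (1 - Real.sigmoid (2 * w))) := by
    rw [← Real.sigmoid_neg, Real.sigmoid_def, Real.sigmoid_def, Real.cosh_eq, neg_neg,
      show -(2 * w) = -w + -w by ring, show 2 * w = w + w by ring, Real.exp_add, Real.exp_add,
      Real.exp_neg]
    have := Real.exp_pos w
    field_simp
    ring
  rw [abs_of_pos (by positivity), ← Complex.ofReal_pow, hsech,
    show (1 : ℂ) - (Real.sigmoid (2 * w) : ℂ) = ((1 - Real.sigmoid (2 * w) : ℝ) : ℂ) by push_cast; rfl,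
    Complex.cpow_def_of_ne_zero (by exact_mod_cast hp.ne'),
    Complex.cpow_def_of_ne_zero (by exact_mod_cast hp'.ne'), ← Complex.exp_add,
    ← Complex.ofReal_log hp.le, ← Complex.ofReal_log hp'.le,
    show Complex.I * y * w = Complex.I * (y / 2) * ((Real.log (Real.sigmoid (2 * w))
      - Real.log (1 - Real.sigmoid (2 * w)) : ℝ) : ℂ) by rw [hlog]; push_cast; ring,
    Complex.real_smul,
    show ∀ a b : ℝ, (a : ℂ) * (1 + Complex.I * (y / 2) - 1) + b * (1 - Complex.I * (y / 2) - 1)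
      = Complex.I * (y / 2) * ((a - b : ℝ) : ℂ) by intro a b; push_cast; ring]
  push_cast
  ring

theorem clh_fourier_transform (ω : ℝ) :
    ∫ y : ℝ, Complex.exp (Complex.I * ω * y) * (clhDensity y : ℂ)
      = (((Real.cosh ω)⁻¹ : ℝ) : ℂ) ^ 2 := by
  have hF : FourierTransform.fourier (fun x : ℝ => ((((Real.cosh x)⁻¹ : ℝ) : ℂ) ^ 2))
      = fun ξ : ℝ => 2 * (π : ℂ) * (clhDensity (2 * π * ξ) : ℂ) := by
    ext ξ
    rw [← clh_density_neg, ← clh_sech_fourier, Real.fourier_real_eq_integral_exp_smul]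
    refine integral_congr_ae (Filter.Eventually.of_forall fun w => ?_)
    simp only [smul_eq_mul]
    congr 2
    push_cast
    ring
  have hint : Integrable
      (FourierTransform.fourier (fun x : ℝ => ((((Real.cosh x)⁻¹ : ℝ) : ℂ) ^ 2))) := by
    rw [hF]
    exact ((clh_density_integrable.comp_mul_left' (R := 2 * π) (by positivity)).ofReal
      (𝕜 := ℂ)).const_mul _
  have hcont : Continuous (fun x : ℝ => ((((Real.cosh x)⁻¹ : ℝ) : ℂ) ^ 2)) := by
    have : Continuous (fun x : ℝ => (Real.cosh x)⁻¹) :=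
      Real.continuous_cosh.inv₀ fun x => (Real.cosh_pos x).ne'
    fun_prop
  have h := congrFun (hcont.fourierInv_fourier_eq clh_sech_integrable hint) ω
  rw [hF, Real.fourierInv_eq'] at h
  rw [← h]
  have hsc := Measure.integral_comp_mul_left
    (fun y : ℝ => Complex.exp (Complex.I * ω * y) * (clhDensity y : ℂ)) (2 * π)
  have hpi : (π : ℂ) ≠ 0 := by exact_mod_cast Real.pi_ne_zero
  have h2 : ∫ y : ℝ, Complex.exp (Complex.I * ω * y) * (clhDensity y : ℂ)
      = (2 * (π : ℂ)) * ∫ x : ℝ, Complex.exp (Complex.I * ω * ((2 * π * x : ℝ) : ℂ))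
        * (clhDensity (2 * π * x) : ℂ) := by
    rw [hsc, abs_of_pos (by positivity), Complex.real_smul]
    push_cast
    field_simp
  rw [h2, ← integral_const_mul]
  refine integral_congr_ae (Filter.Eventually.of_forall fun x => ?_)
  simp only [smul_eq_mul]
  rw [show ∀ a b c : ℂ, a * (b * c) = b * (a * c) by intro a b c; ring]
  congr 2
  simp
  ring_nf
end
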